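/- Let χ₁ and χ₂ be two distinct real non-principal primitive Dirichlet characters of conductors q₁ ≥ 3 and q₂ ≥ 3 respectively, and let β₁ and β₂ be real numbers with L(β₁,χ₁) = 0 and L(β₂,χ₂) = 0. Then min(β₁, β₂) ≤ 1 − 1/(2.0452 · log(q₁ q₂)). -/

import Mathlib

set_option autoImplicit false

open scoped Real

open Complex

section

open MeasureTheory ProbabilityTheory Set Filter Topology
open scoped NNReal ENNReal

/-- `G` agrees on the half-plane `1 < re s` with the two-sided Laplace transform of a positive
measure on the real line. -/
def IsLaplaceTransform (G : ℂ → ℂ) : Prop :=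
  ∃ ν : Measure ℝ, SFinite ν ∧ ∀ s : ℂ, 1 < s.re →
    Integrable (fun x : ℝ ↦ cexp (s * x)) ν ∧ G s = complexMGF id ν s

lemma IsLaplaceTransform.of_map {Ω : Type*} [MeasurableSpace Ω] {μ : Measure Ω} [SFinite μ]
    {X : Ω → ℝ} (hX : Measurable X) {G : ℂ → ℂ}
    (h : ∀ s : ℂ, 1 < s.re →
      Integrable (fun ω ↦ cexp (s * X ω)) μ ∧ G s = ∫ ω, cexp (s * X ω) ∂μ) :
    IsLaplaceTransform G := by
  refine ⟨μ.map X, inferInstance, fun s hs ↦ ⟨?_, ?_⟩⟩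
  · refine (integrable_map_measure ?_ hX.aemeasurable).2 (h s hs).1
    exact (by fun_prop : Continuous fun x : ℝ ↦ cexp (s * x)).aestronglyMeasurable
  · rw [complexMGF_id_map hX.aemeasurable, (h s hs).2]
    rfl

lemma IsLaplaceTransform.of_density {Ω : Type*} [MeasurableSpace Ω] {μ : Measure Ω} [SFinite μ]
    {w : Ω → ℝ≥0} (hw : Measurable w) {X : Ω → ℝ} (hX : Measurable X) {G : ℂ → ℂ}
    (h : ∀ s : ℂ, 1 < s.re → Integrable (fun ω ↦ (w ω : ℂ) * cexp (s * X ω)) μ ∧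
      G s = ∫ ω, (w ω : ℂ) * cexp (s * X ω) ∂μ) :
    IsLaplaceTransform G := by
  refine IsLaplaceTransform.of_map (μ := μ.withDensity fun ω ↦ (w ω : ℝ≥0∞)) hX
    fun s hs ↦ ⟨?_, ?_⟩
  · rw [integrable_withDensity_iff_integrable_smul hw]
    simpa [NNReal.smul_def] using (h s hs).1
  · rw [integral_withDensity_eq_integral_smul hw, (h s hs).2]
    simp [NNReal.smul_def]

lemma IsLaplaceTransform.congr {F G : ℂ → ℂ} (hF : IsLaplaceTransform F)
    (h : ∀ s : ℂ, 1 < s.re → F s = G s) : IsLaplaceTransform G := by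
  obtain ⟨ν, hν, H⟩ := hF
  exact ⟨ν, hν, fun s hs ↦ ⟨(H s hs).1, by rw [← h s hs, (H s hs).2]⟩⟩

lemma IsLaplaceTransform.mul {F G : ℂ → ℂ} (hF : IsLaplaceTransform F)
    (hG : IsLaplaceTransform G) : IsLaplaceTransform fun s ↦ F s * G s := by
  obtain ⟨μ, hμ, hF⟩ := hF
  obtain ⟨ν, hν, hG⟩ := hG
  refine IsLaplaceTransform.of_map (μ := μ.prod ν) (X := fun p : ℝ × ℝ ↦ p.1 + p.2)
    (by fun_prop) fun s hs ↦ ?_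
  have key : (fun p : ℝ × ℝ ↦ cexp (s * ((p.1 + p.2 : ℝ) : ℂ))) =
      fun p ↦ cexp (s * p.1) * cexp (s * p.2) := by
    ext p
    rw [← Complex.exp_add]
    push_cast
    ring_nf
  rw [key]
  refine ⟨(hF s hs).1.mul_prod (hG s hs).1, ?_⟩
  rw [integral_prod_mul (fun x : ℝ ↦ cexp (s * x)) (fun x : ℝ ↦ cexp (s * x)), (hF s hs).2,
    (hG s hs).2]
  rfl

lemma isLaplaceTransform_cpow {c : ℝ} (hc : 0 < c) :
    IsLaplaceTransform fun s ↦ (c : ℂ) ^ s := by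
  refine IsLaplaceTransform.of_map (μ := Measure.dirac ()) (X := fun _ ↦ Real.log c)
    (by fun_prop) fun s _ ↦ ⟨by simp, ?_⟩
  rw [cpow_def_of_ne_zero (by exact_mod_cast hc.ne')]
  simp [Complex.ofReal_log hc.le, mul_comm]

lemma isLaplaceTransform_Gamma {a : ℝ} (ha : 0 ≤ a) :
    IsLaplaceTransform fun s ↦ Gamma ((s + a) / 2) := by
  refine IsLaplaceTransform.of_density (μ := volume.restrict (Ioi 0))
    (w := fun x ↦ (Real.exp (-x) * x ^ (a / 2 - 1)).toNNReal) (by fun_prop)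
    (X := fun x ↦ Real.log x / 2) (by fun_prop) fun s hs ↦ ?_
  have hre : 0 < ((s + a) / 2).re := by
    simp only [Complex.div_ofNat_re, add_re, ofReal_re]
    linarith
  have key : EqOn (fun x : ℝ ↦ ((Real.exp (-x) * x ^ (a / 2 - 1)).toNNReal : ℂ) *
        cexp (s * ((Real.log x / 2 : ℝ) : ℂ)))
      (fun x : ℝ ↦ (Real.exp (-x) : ℂ) * (x : ℂ) ^ ((s + a) / 2 - 1)) (Ioi 0) := by
    intro x (hx : 0 < x)
    have hx' : (x : ℂ) ≠ 0 := by exact_mod_cast hx.ne'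
    have h1 : ((Real.exp (-x) * x ^ (a / 2 - 1)).toNNReal : ℂ) =
        (Real.exp (-x) : ℂ) * cexp (Real.log x * (a / 2 - 1)) := by
      have : ((Real.exp (-x) * x ^ (a / 2 - 1)).toNNReal : ℝ) =
          Real.exp (-x) * Real.exp (Real.log x * (a / 2 - 1)) := by
        rw [Real.coe_toNNReal _ (by positivity), Real.rpow_def_of_pos hx]
      rw [show ((Real.exp (-x) * x ^ (a / 2 - 1)).toNNReal : ℂ) =
        (((Real.exp (-x) * x ^ (a / 2 - 1)).toNNReal : ℝ) : ℂ) from rfl, this]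
      push_cast
      rfl
    simp only [h1]
    rw [cpow_def_of_ne_zero hx', ← Complex.ofReal_log hx.le, mul_assoc, ← Complex.exp_add]
    push_cast
    ring_nf
  refine ⟨(integrableOn_congr_fun key measurableSet_Ioi).2 (GammaIntegral_convergent hre), ?_⟩
  rw [setIntegral_congr_fun measurableSet_Ioi key, Gamma_eq_integral hre]
  rfl

lemma isLaplaceTransform_inv_two_mul_sub_one :
    IsLaplaceTransform fun s ↦ (2 * s - 1)⁻¹ := by
  refine IsLaplaceTransform.of_density (μ := volume.restrict (Ioi 0))
    (w := fun x ↦ (Real.exp x).toNNReal) (by fun_prop)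
    (X := fun x ↦ -2 * x) (by fun_prop) fun s hs ↦ ?_
  have key : (fun x : ℝ ↦ ((Real.exp x).toNNReal : ℂ) * cexp (s * ((-2 * x : ℝ) : ℂ))) =
      fun x : ℝ ↦ cexp (-(2 * s - 1) * x) := by
    ext x
    rw [show ((Real.exp x).toNNReal : ℂ) = (((Real.exp x).toNNReal : ℝ) : ℂ) from rfl,
      Real.coe_toNNReal _ (by positivity), Complex.ofReal_exp, ← Complex.exp_add]
    push_cast
    ring_nf
  have hre : (-(2 * s - 1)).re < 0 := by
    simp
    linarith
  rw [key]
  refine ⟨integrableOn_exp_mul_complex_Ioi hre 0, ?_⟩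
  rw [integral_exp_mul_complex_Ioi hre 0]
  simp [neg_div_neg_eq, -neg_sub]

lemma isLaplaceTransform_Gammaℝ {a : ℝ} (ha : 0 ≤ a) :
    IsLaplaceTransform fun s ↦ Gammaℝ (s + a) := by
  have hπ := Real.pi_pos
  have h0 : ((π : ℝ) : ℂ) ≠ 0 := by exact_mod_cast hπ.ne'
  have h1 : IsLaplaceTransform fun _ ↦ ((π ^ (-a / 2) : ℝ) : ℂ) := by
    have hc : 0 < π ^ (-a / 2) := by positivity
    refine IsLaplaceTransform.of_density (μ := Measure.dirac ())
      (w := fun _ ↦ (π ^ (-a / 2)).toNNReal) (X := fun _ ↦ 0)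
      (by fun_prop) (by fun_prop) fun s _ ↦ ⟨by simp, ?_⟩
    simp only [ofReal_zero, mul_zero, Complex.exp_zero, mul_one, integral_const, probReal_univ,
      one_smul]
    rw [← Real.coe_toNNReal _ hc.le]
    simp
  refine ((h1.mul (isLaplaceTransform_cpow (c := π ^ (-(1 / 2) : ℝ)) (by positivity))).mul
    (isLaplaceTransform_Gamma ha)).congr fun s _ ↦ ?_
  rw [Gammaℝ_def]
  congr 1
  rw [Complex.ofReal_cpow hπ.le, Complex.ofReal_cpow hπ.le, cpow_def_of_ne_zero h0,
    cpow_def_of_ne_zero h0, cpow_def_of_ne_zero (Complex.exp_ne_zero _),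
    cpow_def_of_ne_zero h0, ← Complex.ofReal_log hπ.le]
  have : Complex.log (cexp ((Real.log π : ℂ) * ((-(1 / 2) : ℝ) : ℂ))) =
      (Real.log π : ℂ) * ((-(1 / 2) : ℝ) : ℂ) := by
    rw [← Complex.ofReal_mul, ← Complex.ofReal_exp, ← Complex.ofReal_log (Real.exp_pos _).le,
      Real.log_exp]
  rw [this, ← Complex.exp_add]
  congr 1
  push_cast
  ring

lemma isLaplaceTransform_LSeries {f : ℕ → ℝ} (hf : ∀ n, 0 ≤ f n)
    (hs : ∀ s : ℂ, 1 < s.re → LSeriesSummable (fun n ↦ (f n : ℂ)) s) :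
    IsLaplaceTransform (LSeries fun n ↦ (f n : ℂ)) := by
  refine IsLaplaceTransform.of_density (μ := (Measure.count : Measure ℕ))
    (w := fun n ↦ if n = 0 then 0 else (f n).toNNReal) (measurable_of_countable _)
    (X := fun n ↦ -Real.log n) (measurable_of_countable _) fun s hs' ↦ ?_
  have key : (fun n : ℕ ↦ (((if n = 0 then 0 else (f n).toNNReal : ℝ≥0) : ℝ≥0) : ℂ) *
      cexp (s * ((-Real.log n : ℝ) : ℂ))) = LSeries.term (fun n ↦ (f n : ℂ)) s := by
    ext n
    rw [LSeries.term_def]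
    split_ifs with hn
    · simp
    · have hn' : (n : ℂ) ≠ 0 := by exact_mod_cast hn
      rw [show ((f n).toNNReal : ℂ) = (((f n).toNNReal : ℝ) : ℂ) from rfl,
        Real.coe_toNNReal _ (hf n), cpow_def_of_ne_zero hn', div_eq_mul_inv, ← Complex.exp_neg,
        Complex.ofReal_neg, ← Complex.natCast_log]
      ring_nf
  have hint : Integrable (LSeries.term (fun n ↦ (f n : ℂ)) s) Measure.count :=
    integrable_count_iff.2 (hs s hs').norm
  rw [key]
  refine ⟨hint, ?_⟩
  rw [integral_countable hint]
  simp [LSeries]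

/-- `f` is bounded on every vertical strip of finite width. -/
def BoundedOnStrips (f : ℂ → ℂ) : Prop :=
  ∀ a b : ℝ, ∃ C, ∀ s : ℂ, a ≤ s.re → s.re ≤ b → ‖f s‖ ≤ C

namespace BoundedOnStrips

lemma add {f g : ℂ → ℂ} (hf : BoundedOnStrips f) (hg : BoundedOnStrips g) :
    BoundedOnStrips fun s ↦ f s + g s := fun a b ↦ by
  obtain ⟨C, hC⟩ := hf a b
  obtain ⟨D, hD⟩ := hg a b
  exact ⟨C + D, fun s h1 h2 ↦ (norm_add_le _ _).trans (add_le_add (hC s h1 h2) (hD s h1 h2))⟩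

lemma mul {f g : ℂ → ℂ} (hf : BoundedOnStrips f) (hg : BoundedOnStrips g) :
    BoundedOnStrips fun s ↦ f s * g s := fun a b ↦ by
  obtain ⟨C, hC⟩ := hf a b
  obtain ⟨D, hD⟩ := hg a b
  refine ⟨C * D, fun s h1 h2 ↦ ?_⟩
  rw [norm_mul]
  exact mul_le_mul (hC s h1 h2) (hD s h1 h2) (norm_nonneg _) ((norm_nonneg _).trans (hC s h1 h2))

lemma const (c : ℂ) : BoundedOnStrips fun _ ↦ c := fun _ _ ↦ ⟨‖c‖, fun _ _ _ ↦ le_rfl⟩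

lemma sum {ι : Type*} (t : Finset ι) {f : ι → ℂ → ℂ} (hf : ∀ i ∈ t, BoundedOnStrips (f i)) :
    BoundedOnStrips fun s ↦ ∑ i ∈ t, f i s := by
  induction t using Finset.cons_induction with
  | empty => simpa using const 0
  | cons i t hi ih =>
    simp only [Finset.sum_cons]
    exact (hf i (by simp)).add (ih fun j hj ↦ hf j (by simp [hj]))

/-- Precomposition with a real affine map. -/
lemma comp_affine {f : ℂ → ℂ} (hf : BoundedOnStrips f) (c d : ℝ) :
    BoundedOnStrips fun s ↦ f (c * s + d) := fun a b ↦ by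
  obtain ⟨C, hC⟩ := hf (min (c * a) (c * b) + d) (max (c * a) (c * b) + d)
  refine ⟨C, fun s h1 h2 ↦ hC _ ?_ ?_⟩ <;>
  simp only [add_re, re_ofReal_mul, ofReal_re, add_le_add_iff_right]
  · rcases le_total 0 c with h | h
    · exact (min_le_left _ _).trans (mul_le_mul_of_nonneg_left h1 h)
    · exact (min_le_right _ _).trans (mul_le_mul_of_nonpos_left h2 h)
  · rcases le_total 0 c with h | h
    · exact (mul_le_mul_of_nonneg_left h2 h).trans (le_max_right _ _)
    · exact (mul_le_mul_of_nonpos_left h1 h).trans (le_max_left _ _)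

lemma cpow {c : ℝ} (hc : 0 < c) : BoundedOnStrips fun s ↦ (c : ℂ) ^ s := fun a b ↦ by
  refine ⟨c ^ a + c ^ b, fun s h1 h2 ↦ ?_⟩
  rw [Complex.norm_cpow_eq_rpow_re_of_pos hc]
  rcases le_total 1 c with h | h
  · exact (Real.rpow_le_rpow_of_exponent_le h h2).trans (le_add_of_nonneg_left (by positivity))
  · exact (Real.rpow_le_rpow_of_exponent_ge hc h h1).trans
      (le_add_of_nonneg_right (by positivity))

lemma mellin {f : ℝ → ℂ} (hf : ∀ s, MellinConvergent f s) : BoundedOnStrips (mellin f) := by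
  intro a b
  have hint (c : ℝ) : IntegrableOn (fun t : ℝ ↦ t ^ (c - 1) * ‖f t‖) (Ioi 0) := by
    refine (integrableOn_congr_fun (fun t (ht : 0 < t) ↦ ?_) measurableSet_Ioi).1
      (Integrable.norm (hf c))
    simp only [norm_smul, Complex.norm_cpow_eq_rpow_re_of_pos ht]
    simp
  refine ⟨∫ t in Ioi (0 : ℝ), (t ^ (a - 1) * ‖f t‖ + t ^ (b - 1) * ‖f t‖), fun s h1 h2 ↦ ?_⟩
  refine norm_integral_le_of_norm_le ((hint a).add (hint b)) ?_
  refine (ae_restrict_iff' measurableSet_Ioi).2 (Eventually.of_forall fun t (ht : 0 < t) ↦ ?_)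
  rw [norm_smul, Complex.norm_cpow_eq_rpow_re_of_pos ht, ← add_mul]
  refine mul_le_mul_of_nonneg_right ?_ (norm_nonneg _)
  simp only [sub_re, one_re]
  rcases le_total 1 t with h | h
  · exact (Real.rpow_le_rpow_of_exponent_le h (by linarith)).trans
      (le_add_of_nonneg_left (by positivity))
  · exact (Real.rpow_le_rpow_of_exponent_ge ht h (by linarith)).trans
      (le_add_of_nonneg_right (by positivity))

end BoundedOnStrips

lemma boundedOnStrips_completedHurwitzZetaEven₀ (a : UnitAddCircle) :
    BoundedOnStrips (HurwitzZeta.completedHurwitzZetaEven₀ a) := by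
  set P := HurwitzZeta.hurwitzEvenFEPair a with hP
  have h : BoundedOnStrips P.Λ₀ :=
    BoundedOnStrips.mellin fun s ↦ (P.isStrongFEPair_toStrongFEPair.hasMellin s).1
  have := (h.comp_affine (1 / 2) 0).mul (BoundedOnStrips.const (1 / 2))
  convert this using 2 with s
  simp only [HurwitzZeta.completedHurwitzZetaEven₀, ← hP]
  push_cast
  ring_nf

lemma boundedOnStrips_completedHurwitzZetaOdd (a : UnitAddCircle) :
    BoundedOnStrips (HurwitzZeta.completedHurwitzZetaOdd a) := by
  set P := HurwitzZeta.hurwitzOddFEPair a with hP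
  have hs := HurwitzZeta.isStrong_hurwitzOddFEPair a
  have h : BoundedOnStrips P.Λ := by
    rw [hs.Λ_eq]
    exact BoundedOnStrips.mellin fun s ↦ (hs.hasMellin s).1
  have := (h.comp_affine (1 / 2) (1 / 2)).mul (BoundedOnStrips.const (1 / 2))
  convert this using 2 with s
  simp only [HurwitzZeta.completedHurwitzZetaOdd, ← hP]
  push_cast
  ring_nf

lemma boundedOnStrips_completedRiemannZeta₀ : BoundedOnStrips completedRiemannZeta₀ :=
  boundedOnStrips_completedHurwitzZetaEven₀ 0

lemma boundedOnStrips_completedLFunction {N : ℕ} [NeZero N] {χ : DirichletCharacter ℂ N}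
    (hχ : χ ≠ 1) : BoundedOnStrips (DirichletCharacter.completedLFunction χ) := by
  have hN : 1 < N := by
    have := NeZero.pos N
    by_contra h
    exact hχ (χ.level_one' (by omega))
  have key (s : ℂ) : DirichletCharacter.completedLFunction χ s =
      ZMod.completedLFunction₀ χ s := by
    rw [DirichletCharacter.completedLFunction, ZMod.completedLFunction_eq,
      χ.map_zero' hN.ne', MulChar.sum_eq_zero_of_ne_one hχ]
    simp
  have hpow : BoundedOnStrips fun s ↦ (N : ℂ) ^ (-s) := by
    have := (BoundedOnStrips.cpow (c := N) (by exact_mod_cast NeZero.pos N)).comp_affine (-1) 0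
    convert this using 2 with s
    simp
  rw [funext key]
  unfold ZMod.completedLFunction₀
  refine (hpow.mul (.sum _ fun i _ ↦ .mul (.const _) ?_)).add
    (hpow.mul (.sum _ fun i _ ↦ .mul (.const _) ?_))
  · exact boundedOnStrips_completedHurwitzZetaEven₀ _
  · exact boundedOnStrips_completedHurwitzZetaOdd _

lemma integrable_rexp_restrict_Ioi {ν : Measure ℝ}
    (h : ∀ s : ℂ, 1 < s.re → Integrable (fun x : ℝ ↦ cexp (s * x)) ν) (t : ℝ) :
    Integrable (fun x : ℝ ↦ rexp (t * x)) (ν.restrict (Ioi 0)) := by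
  have h2 : Integrable (fun x : ℝ ↦ rexp (max t 2 * x)) ν := by
    have := (h (max t 2 : ℝ) (by simp)).norm
    refine this.congr (Eventually.of_forall fun x ↦ ?_)
    simp [Complex.norm_exp]
  refine (h2.restrict (s := Ioi 0)).mono' (by fun_prop) ?_
  refine (ae_restrict_iff' measurableSet_Ioi).2 (Eventually.of_forall fun x (hx : 0 < x) ↦ ?_)
  rw [Real.norm_of_nonneg (Real.exp_pos _).le, Real.exp_le_exp]
  exact mul_le_mul_of_nonneg_right (le_max_left _ _) hx.le

lemma mgf_restrict_Ioi_mono {ν : Measure ℝ}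
    (h : ∀ t : ℝ, Integrable (fun x : ℝ ↦ rexp (t * x)) (ν.restrict (Ioi 0))) {t u : ℝ}
    (htu : t ≤ u) : mgf id (ν.restrict (Ioi 0)) t ≤ mgf id (ν.restrict (Ioi 0)) u := by
  refine setIntegral_mono_on (h t) (h u) measurableSet_Ioi fun x (hx : 0 < x) ↦ ?_
  rw [Real.exp_le_exp]
  exact mul_le_mul_of_nonneg_right htu hx.le

lemma tendsto_mgf_restrict_Ioi {ν : Measure ℝ}
    (h : ∀ t : ℝ, Integrable (fun x : ℝ ↦ rexp (t * x)) (ν.restrict (Ioi 0))) :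
    Tendsto (fun t : ℝ ↦ mgf id (ν.restrict (Ioi 0)) (1 - t)) atTop (𝓝 0) := by
  have := tendsto_integral_filter_of_dominated_convergence (μ := ν.restrict (Ioi 0))
    (l := atTop) (F := fun t x : ℝ ↦ rexp ((1 - t) * x)) (f := fun _ ↦ (0 : ℝ))
    (fun x ↦ rexp (0 * x)) (Eventually.of_forall fun t ↦ (h (1 - t)).aestronglyMeasurable) ?_ (h 0)
    ?_
  · simpa [mgf] using this
  · filter_upwards [eventually_ge_atTop 1] with t ht
    refine (ae_restrict_iff' measurableSet_Ioi).2 (Eventually.of_forall fun x (hx : 0 < x) ↦ ?_)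
    rw [Real.norm_of_nonneg (Real.exp_pos _).le, Real.exp_le_exp]
    exact mul_le_mul_of_nonneg_right (by linarith) hx.le
  · refine (ae_restrict_iff' measurableSet_Ioi).2 (Eventually.of_forall fun x (hx : 0 < x) ↦ ?_)
    refine Real.tendsto_exp_atBot.comp ?_
    refine Tendsto.atBot_mul_const hx ?_
    exact tendsto_atBot_add_const_left atTop 1 tendsto_neg_atTop_atBot

/-- A Laplace transform that continues to a symmetric entire function, up to a pair of symmetric
poles, is on the real line a symmetrized moment generating function plus a nonnegative constant. -/
theorem exists_eq_mgf_add_mgf_one_sub {G N : ℂ → ℂ} {R : ℂ} (hG : IsLaplaceTransform G)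
    (hN : Differentiable ℂ N) (hb : ∃ C, ∀ s : ℂ, -1 ≤ s.re → s.re ≤ 2 → ‖N s‖ ≤ C)
    (hsymm : ∀ s, N (1 - s) = N s)
    (hGN : ∀ s : ℂ, 1 < s.re → G s = N s - R / (s * (1 - s))) :
    ∃ (μ : Measure ℝ) (c : ℝ), 0 ≤ c ∧ (∀ t : ℝ, Integrable (fun x ↦ rexp (t * x)) μ) ∧
      ∀ t : ℝ, (N t).re = mgf id μ t + mgf id μ (1 - t) + c := by
  obtain ⟨ν, _, hν⟩ := hG
  set μ := ν.restrict (Ioi 0) with hμ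
  set ρ := ν.restrict (Iic 0) with hρ
  have hint : ∀ t : ℝ, Integrable (fun x ↦ rexp (t * x)) μ :=
    integrable_rexp_restrict_Ioi fun s hs ↦ (hν s hs).1
  have hset : integrableExpSet id μ = univ := by
    ext t
    simpa [integrableExpSet] using hint t
  have hA : Differentiable ℂ (complexMGF id μ) := by
    have := differentiableOn_complexMGF (X := id) (μ := μ)
    rw [hset] at this
    simpa [differentiableOn_univ] using this
  have hsplit (s : ℂ) (hs : 1 < s.re) : G s = complexMGF id μ s + complexMGF id ρ s := by
    rw [(hν s hs).2, add_comm]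
    have := integral_add_compl (μ := ν) (measurableSet_Iic (a := (0 : ℝ))) (hν s hs).1
    rw [compl_Iic] at this
    exact this.symm
  have hρint (t : ℝ) (ht : 1 < t) : Integrable (fun x ↦ rexp (t * x)) ρ := by
    have := ((hν t (by simpa)).1.norm).restrict (s := Iic 0)
    refine this.congr (Eventually.of_forall fun x ↦ ?_)
    simp [Complex.norm_exp]
  have hρmono (t : ℝ) (ht : 2 ≤ t) : mgf id ρ t ≤ mgf id ρ 2 := by
    refine setIntegral_mono_on (hρint t (by linarith)) (hρint 2 (by norm_num)) measurableSet_Iic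
      fun x (hx : x ≤ 0) ↦ ?_
    rw [Real.exp_le_exp]
    exact mul_le_mul_of_nonpos_right ht hx
  set E : ℂ → ℂ := fun s ↦ N s - complexMGF id μ s - complexMGF id μ (1 - s) with hE
  have hEd : Differentiable ℂ E :=
    (hN.sub hA).sub (hA.comp (differentiable_const 1 |>.sub differentiable_id))
  have hEsymm (s : ℂ) : E (1 - s) = E s := by
    simp only [hE, hsymm, sub_sub_cancel]
    ring
  have hEright (s : ℂ) (hs : 1 < s.re) :
      E s = complexMGF id ρ s + R / (s * (1 - s)) - complexMGF id μ (1 - s) := by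
    have h1 := hGN s hs
    rw [hsplit s hs] at h1
    simp only [hE]
    linear_combination -h1
  have hμle (s : ℂ) (u : ℝ) (hs : s.re ≤ u) : ‖complexMGF id μ s‖ ≤ mgf id μ u :=
    norm_complexMGF_le_mgf.trans (mgf_restrict_Ioi_mono hint hs)
  obtain ⟨C, hC⟩ := hb
  have hright (s : ℂ) (hs : 2 ≤ s.re) : ‖E s‖ ≤ mgf id ρ 2 + ‖R‖ + mgf id μ 2 := by
    rw [hEright s (by linarith)]
    refine (norm_sub_le _ _).trans (add_le_add ((norm_add_le _ _).trans (add_le_add ?_ ?_))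
      (hμle _ _ (by simp; linarith)))
    · exact norm_complexMGF_le_mgf.trans (hρmono _ hs)
    · rw [norm_div, norm_mul]
      refine div_le_self (norm_nonneg _) ?_
      have h1 : 1 ≤ ‖s‖ := by linarith [Complex.re_le_norm s]
      have h2 : 1 ≤ ‖1 - s‖ := by
        have := Complex.re_le_norm (-(1 - s))
        rw [norm_neg] at this
        simp at this
        linarith
      nlinarith
  have hstrip (s : ℂ) (h1 : -1 ≤ s.re) (h2 : s.re ≤ 2) :
      ‖E s‖ ≤ C + mgf id μ 2 + mgf id μ 2 := by
    refine (norm_sub_le _ _).trans (add_le_add ((norm_sub_le _ _).trans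
      (add_le_add (hC s h1 h2) (hμle _ _ h2))) (hμle _ _ ?_))
    simp
    linarith
  have hbdd : Bornology.IsBounded (range E) := by
    refine isBounded_iff_forall_norm_le.2
      ⟨max (mgf id ρ 2 + ‖R‖ + mgf id μ 2) (C + mgf id μ 2 + mgf id μ 2), ?_⟩
    rintro _ ⟨s, rfl⟩
    rcases le_total 2 s.re with h | h
    · exact (hright s h).trans (le_max_left _ _)
    rcases le_total (-1) s.re with h' | h'
    · exact (hstrip s h' h).trans (le_max_right _ _)
    · rw [← hEsymm]
      exact (hright _ (by simp; linarith)).trans (le_max_left _ _)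
  obtain ⟨c, hc⟩ := hEd.exists_const_forall_eq_of_bounded hbdd
  have hone (t : ℝ) : complexMGF id μ (1 - (t : ℂ)) = mgf id μ (1 - t) := by
    rw [← complexMGF_ofReal]
    push_cast
    rfl
  refine ⟨μ, c.re, ?_, hint, fun t ↦ ?_⟩
  · have h1 : Tendsto (fun t : ℝ ↦ (R / (t * (1 - t))).re - mgf id μ (1 - t)) atTop (𝓝 0) := by
      have hz : Tendsto (fun t : ℝ ↦ R / ((t : ℂ) * (1 - t))) atTop (𝓝 0) := by
        rw [tendsto_zero_iff_norm_tendsto_zero]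
        have hz' : Tendsto (fun t : ℝ ↦ ‖R‖ / t) atTop (𝓝 0) := tendsto_id.const_div_atTop _
        refine squeeze_zero' (Eventually.of_forall fun t ↦ norm_nonneg _) ?_ hz'
        filter_upwards [eventually_ge_atTop 2] with t ht
        rw [norm_div, norm_mul]
        refine div_le_div_of_nonneg_left (norm_nonneg _) (by linarith) ?_
        rw [← Complex.ofReal_one, ← Complex.ofReal_sub, Complex.norm_real, Complex.norm_real,
          Real.norm_of_nonneg (by linarith), Real.norm_of_nonpos (by linarith)]
        nlinarith
      have := ((Complex.continuous_re.tendsto 0).comp hz).sub (tendsto_mgf_restrict_Ioi hint)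
      simpa using this
    refine le_of_tendsto h1 ?_
    filter_upwards [eventually_gt_atTop 1] with t ht
    have h3 := congrArg Complex.re (hEright t (by simpa))
    rw [hc, sub_re, add_re, hone, complexMGF_ofReal, ofReal_re, ofReal_re] at h3
    have := mgf_nonneg (X := id) (μ := ρ) (t := t)
    linarith
  · have h1 := congrArg Complex.re (hc t)
    simp only [hE, hone, complexMGF_ofReal, sub_re, ofReal_re] at h1
    linarith

lemma convexOn_exp_mul_mgf {μ : Measure ℝ} (h : ∀ t : ℝ, Integrable (fun x ↦ rexp (t * x)) μ)
    (C : ℝ) : ConvexOn ℝ univ fun t ↦ rexp (-(C * t)) * mgf id μ t := by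
  have h1 (t : ℝ) : rexp (-(C * t)) * mgf id μ t = ∫ x, rexp (t * (x - C)) ∂μ := by
    rw [mgf, ← integral_const_mul]
    refine integral_congr_ae (Eventually.of_forall fun x ↦ ?_)
    simp only [id, ← Real.exp_add]
    ring_nf
  have h2 (t : ℝ) : Integrable (fun x ↦ rexp (t * (x - C))) μ := by
    refine ((h t).const_mul (rexp (-(C * t)))).congr (Eventually.of_forall fun x ↦ ?_)
    simp only [← Real.exp_add]
    ring_nf
  refine ⟨convex_univ, fun t _ u _ a b ha hb hab ↦ ?_⟩
  simp only [h1, smul_eq_mul, ← integral_const_mul]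
  rw [← integral_add ((h2 t).const_mul a) ((h2 u).const_mul b)]
  refine integral_mono (h2 _) (((h2 t).const_mul a).add ((h2 u).const_mul b)) fun x ↦ ?_
  have := convexOn_exp.2 (mem_univ (t * (x - C))) (mem_univ (u * (x - C))) ha hb hab
  simp only [smul_eq_mul] at this
  convert this using 2
  ring

lemma convexOn_exp_mul_symm {μ : Measure ℝ} {c : ℝ} {J : ℝ → ℝ} (hc : 0 ≤ c)
    (h : ∀ t : ℝ, Integrable (fun x ↦ rexp (t * x)) μ)
    (hJ : ∀ t, J t = mgf id μ t + mgf id μ (1 - t) + c) (C : ℝ) :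
    ConvexOn ℝ univ fun t ↦ rexp (-(C * t)) * J t := by
  have h1 := convexOn_exp_mul_mgf h C
  have h2 := ((convexOn_exp_mul_mgf h (-C)).comp_affineMap
    (AffineMap.lineMap (1 : ℝ) (0 : ℝ))).smul (Real.exp_pos (-C)).le
  have h3 : ConvexOn ℝ univ fun t : ℝ ↦ c * rexp (-(C * t)) := by
    simpa [Function.comp_def] using
      (convexOn_exp.comp_linearMap (LinearMap.mulLeft ℝ (-C))).smul hc
  refine ((h1.add h2).add h3).congr fun t _ ↦ ?_
  simp only [Pi.add_apply, Function.comp_apply, AffineMap.lineMap_apply, hJ, smul_eq_mul]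
  have : rexp (-(C * t)) = rexp (-C) * rexp (-(-C * (1 - t))) := by
    rw [← Real.exp_add]
    ring_nf
  simp only [vsub_eq_sub, zero_sub, vadd_eq_add]
  rw [show t * -1 + 1 = 1 - t by ring]
  linear_combination (-mgf id μ (1 - t)) * this

/-- If `e ^ (-C t) J t` is convex for every `C` and `x (1 - x) J x - R` has two zeros on `(0, 1)`
to the right of `β`, then `J` grows at least exponentially to the right. -/
lemma exp_mul_le_of_two_zeros {J : ℝ → ℝ} {R β β' : ℝ}
    (hJ : ∀ C, ConvexOn ℝ univ fun t ↦ rexp (-(C * t)) * J t) (hd : Differentiable ℝ J)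
    (h0 : 0 ≤ J 2) (hβ : 0 < β) (hββ' : β ≤ β') (hβ' : β' < 1)
    (hz : β * (1 - β) * J β = R) (hz' : β' * (1 - β') * J β' = R)
    (heq : β = β' → (1 - 2 * β) * J β + β * (1 - β) * deriv J β = 0) :
    rexp (2 * (1 / (1 - β) - 1 / β)) * J 2 ≤ J 4 := by
  have hder (t : ℝ) : HasDerivAt (fun x ↦ x * (1 - x) * J x)
      ((1 - 2 * t) * J t + t * (1 - t) * deriv J t) t := by
    have h1 := ((hasDerivAt_id t).mul ((hasDerivAt_id t).const_sub 1)).mul (hd t).hasDerivAt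
    refine h1.congr_deriv ?_
    simp only [id, Pi.mul_apply]
    ring
  obtain ⟨s, hs1, hs2, hs⟩ : ∃ s, β ≤ s ∧ s ≤ β' ∧
      (1 - 2 * s) * J s + s * (1 - s) * deriv J s = 0 := by
    rcases hββ'.eq_or_lt with h | h
    · exact ⟨β, le_rfl, hββ', heq h⟩
    · obtain ⟨s, hs, hs'⟩ := exists_hasDerivAt_eq_zero h
        (fun x _ ↦ (hder x).continuousAt.continuousWithinAt) (hz.trans hz'.symm)
        (fun x _ ↦ hder x)
      exact ⟨s, hs.1.le, hs.2.le, hs'⟩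
  have hs0 : 0 < s := by linarith
  have hs3 : 0 < 1 - s := by linarith
  set C := 1 / (1 - s) - 1 / s with hC
  have hds : deriv J s = C * J s := by
    rw [hC]
    field_simp
    linear_combination hs
  have hh : HasDerivAt (fun t ↦ rexp (-(C * t)) * J t) 0 s := by
    have h1 := (((hasDerivAt_id s).const_mul C).neg.exp).mul (hd s).hasDerivAt
    refine h1.congr_deriv ?_
    simp only [id, hds]
    ring
  have hslope (y : ℝ) (hy : s < y) : rexp (-(C * s)) * J s ≤ rexp (-(C * y)) * J y := by
    have := (hJ C).le_slope_of_hasDerivAt (mem_univ s) (mem_univ y) hy hh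
    rw [slope_def_field] at this
    have h2 := mul_nonneg this (by linarith : 0 ≤ y - s)
    rw [div_mul_cancel₀ _ (by linarith : y - s ≠ 0)] at h2
    linarith
  have h24 : rexp (-(C * 2)) * J 2 ≤ rexp (-(C * 4)) * J 4 := by
    have := (hJ C).le_max_of_mem_Icc (mem_univ s) (mem_univ 4)
      (⟨by linarith, by norm_num⟩ : (2 : ℝ) ∈ Icc s 4)
    exact this.trans (max_le (hslope 4 (by linarith)) le_rfl)
  have hle : rexp (C * 2) * J 2 ≤ J 4 := by
    have := mul_le_mul_of_nonneg_left h24 (Real.exp_pos (C * 4)).le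
    rw [← mul_assoc, ← mul_assoc, ← Real.exp_add, ← Real.exp_add] at this
    ring_nf at this ⊢
    simpa using this
  refine le_trans (mul_le_mul_of_nonneg_right (Real.exp_le_exp.2 ?_) h0) hle
  have h1 : 1 / (1 - β) ≤ 1 / (1 - s) := one_div_le_one_div_of_le hs3 (by linarith)
  have h2 : 1 / s ≤ 1 / β := one_div_le_one_div_of_le hβ hs1
  rw [hC]
  linarith

lemma exists_bound_strip_of_factor {M M₂ : ℂ → ℂ} {R : ℂ} (hM : BoundedOnStrips M)
    (hM₂ : Continuous M₂) (h : ∀ s, s * (s - 1) * M₂ s = M s - R) :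
    ∃ C, ∀ s : ℂ, -1 ≤ s.re → s.re ≤ 2 → ‖M₂ s‖ ≤ C := by
  obtain ⟨C, hC⟩ := hM (-1) 2
  obtain ⟨D, hD⟩ := ((isCompact_Icc (a := (-1 : ℝ)) (b := 2)).reProdIm
    (isCompact_Icc (a := (-1 : ℝ)) (b := 1))).exists_bound_of_continuousOn hM₂.continuousOn
  refine ⟨max D (C + ‖R‖), fun s h1 h2 ↦ ?_⟩
  by_cases him : |s.im| ≤ 1
  · exact (hD s ⟨⟨h1, h2⟩, abs_le.1 him⟩).trans (le_max_left _ _)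
  · push Not at him
    refine le_trans ?_ (le_max_right _ _)
    have h3 : 1 ≤ ‖s‖ := him.le.trans (Complex.abs_im_le_norm s)
    have h4 : 1 ≤ ‖s - 1‖ := by
      have := Complex.abs_im_le_norm (s - 1)
      simp at this
      linarith
    calc ‖M₂ s‖ = 1 * 1 * ‖M₂ s‖ := by ring
      _ ≤ ‖s‖ * ‖s - 1‖ * ‖M₂ s‖ := by gcongr
      _ = ‖M s - R‖ := by rw [← h, norm_mul, norm_mul]
      _ ≤ C + ‖R‖ := (norm_sub_le _ _).trans (by gcongr; exact hC s h1 h2)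

lemma exists_factor_of_symm {M : ℂ → ℂ} (hM : Differentiable ℂ M)
    (hsymm : ∀ s, M (1 - s) = M s) :
    ∃ M₂ : ℂ → ℂ, Differentiable ℂ M₂ ∧ (∀ s, s * (s - 1) * M₂ s = M s - M 0) ∧
      ∀ s, M₂ (1 - s) = M₂ s := by
  have hM₁ : Differentiable ℂ (dslope M 0) := by
    rw [← differentiableOn_univ] at hM ⊢
    exact (Complex.differentiableOn_dslope univ_mem).2 hM
  have hM₂ : Differentiable ℂ (dslope (dslope M 0) 1) := by
    rw [← differentiableOn_univ] at hM₁ ⊢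
    exact (Complex.differentiableOn_dslope univ_mem).2 hM₁
  have h1 (s : ℂ) : s * dslope M 0 s = M s - M 0 := by
    simpa using sub_smul_dslope M 0 s
  have h10 : dslope M 0 1 = 0 := by
    have := h1 1
    rwa [one_mul, ← hsymm 0, sub_zero, sub_self] at this
  have h2 (s : ℂ) : s * (s - 1) * dslope (dslope M 0) 1 s = M s - M 0 := by
    have := sub_smul_dslope (dslope M 0) 1 s
    rw [h10, sub_zero, smul_eq_mul] at this
    rw [mul_assoc, this, h1]
  refine ⟨_, hM₂, h2, fun s ↦ ?_⟩
  have hdense : Dense ({0, 1}ᶜ : Set ℂ) := Set.Countable.dense_compl ℂ (Set.toFinite _).countable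
  refine congrFun (Continuous.ext_on hdense
    (hM₂.continuous.comp (continuous_const.sub continuous_id)) hM₂.continuous fun z hz ↦ ?_) s
  simp only [mem_compl_iff, mem_insert_iff, mem_singleton_iff, not_or] at hz
  have h3 := h2 (1 - z)
  rw [hsymm, ← h2 z] at h3
  refine mul_left_cancel₀ (mul_ne_zero hz.1 (sub_ne_zero.2 hz.2)) ?_
  simp only [Function.comp_apply, Pi.sub_apply, id]
  rw [← h3]
  ring

theorem exp_mul_le_of_completedZeta_mul {M : ℂ → ℂ} (hM : Differentiable ℂ M)
    (hMb : BoundedOnStrips M) (hsymm : ∀ s, M (1 - s) = M s)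
    (hL : IsLaplaceTransform fun s ↦ completedRiemannZeta s * M s)
    {β β' : ℝ} (hβ : 0 < β) (hββ' : β ≤ β')
    (hβ' : β' < 1) (hz : M β = 0) (hz' : M β' = 0) (heq : β = β' → deriv M β = 0) :
    rexp (2 * (1 / (1 - β) - 1 / β)) * (8 / 9 * ‖completedRiemannZeta 2 * M 2‖) ≤
      ‖completedRiemannZeta 4 * M 4‖ := by
  obtain ⟨M₂, hM₂, hfac, hsymm₂⟩ := exists_factor_of_symm hM hsymm
  obtain ⟨C₀, hC₀⟩ := exists_bound_strip_of_factor hMb hM₂.continuous hfac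
  obtain ⟨C₁, hC₁⟩ := (boundedOnStrips_completedRiemannZeta₀.mul hMb) (-1) 2
  set R := M 0 with hR
  set N : ℂ → ℂ := fun s ↦ completedRiemannZeta₀ s * M s + M₂ s with hN
  have hNd : Differentiable ℂ N := (differentiable_completedZeta₀.mul hM).add hM₂
  have hGN (s : ℂ) (h0 : s ≠ 0) (h1 : 1 - s ≠ 0) :
      completedRiemannZeta s * M s = N s - R / (s * (1 - s)) := by
    rw [completedRiemannZeta_eq]
    simp only [hN]
    have := hfac s
    field_simp
    linear_combination this
  obtain ⟨μ, c, hc, hint, hJ⟩ := exists_eq_mgf_add_mgf_one_sub (R := R) hL hNd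
    ⟨C₁ + C₀, fun s h1 h2 ↦ (norm_add_le _ _).trans (add_le_add (hC₁ s h1 h2) (hC₀ s h1 h2))⟩
    (fun s ↦ by simp only [hN, completedRiemannZeta₀_one_sub, hsymm, hsymm₂])
    (fun s hs ↦ hGN s (by rintro rfl; simp at hs; linarith)
      (by intro h; rw [← sub_eq_zero.1 h] at hs; simp at hs))
  have hconv := convexOn_exp_mul_symm hc hint hJ
  have hJnonneg (t : ℝ) : 0 ≤ (N t).re := by
    rw [hJ]
    have h1 := mgf_nonneg (X := id) (μ := μ) (t := t)
    have h2 := mgf_nonneg (X := id) (μ := μ) (t := 1 - t)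
    linarith
  have hJder (t : ℝ) : HasDerivAt (fun x : ℝ ↦ (N x).re) (deriv N t).re t :=
    (hNd t).hasDerivAt.real_of_complex
  have hzero (t : ℝ) (ht : M t = 0) : t * (1 - t) * (N t).re = R.re := by
    have h1 := hfac t
    have h2 : ((t * (1 - t) : ℝ) : ℂ) * N t = R := by
      push_cast
      simp only [hN, ht] at h1 ⊢
      linear_combination -h1
    rw [← re_ofReal_mul, h2]
  have hdouble (h : β = β') :
      (1 - 2 * β) * (N β).re + β * (1 - β) * deriv (fun x : ℝ ↦ (N x).re) β = 0 := by
    rw [(hJder β).deriv]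
    have hc : (fun s : ℂ ↦ s * (1 - s) * N s +
        (1 - s * (1 - s) * completedRiemannZeta₀ s) * M s) = fun _ ↦ R := by
      ext s
      have := hfac s
      simp only [hN]
      linear_combination -this
    have hs (s : ℂ) : HasDerivAt (fun s : ℂ ↦ s * (1 - s)) (1 - 2 * s) s := by
      refine ((hasDerivAt_id s).mul ((hasDerivAt_id s).const_sub 1)).congr_deriv ?_
      simp only [id]
      ring
    have h1 := ((hs β).mul (hNd β).hasDerivAt).add ((((hs β).mul
      (differentiable_completedZeta₀ β).hasDerivAt).const_sub 1).mul (hM β).hasDerivAt)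
    have h2 := (h1.congr_deriv rfl).unique ((hasDerivAt_const (β : ℂ) R).congr_of_eventuallyEq
      (Eventually.of_forall fun s ↦ congrFun hc s))
    simp only [hz, heq h, mul_zero, add_zero] at h2
    have h3 : (((1 - 2 * β : ℝ) : ℂ) * N β + ((β * (1 - β) : ℝ) : ℂ) * deriv N β) = 0 := by
      push_cast
      exact h2
    have := congrArg Complex.re h3
    rwa [add_re, re_ofReal_mul, re_ofReal_mul, zero_re] at this
  have hmain := exp_mul_le_of_two_zeros hconv (fun t ↦ (hJder t).differentiableAt)
    (hJnonneg 2) hβ hββ' hβ' (hzero β hz) (hzero β' hz') hdouble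
  have hRβ : β * (1 - β) * (N β).re = R.re := hzero β hz
  have hR0 : 0 ≤ R.re := by
    rw [← hRβ]
    exact mul_nonneg (mul_nonneg hβ.le (by linarith)) (hJnonneg β)
  have hβ2 : (N β).re ≤ (N 2).re := by
    have h1 : (N (-1 : ℝ)).re = (N (2 : ℝ)).re := by
      rw [hJ, hJ]
      norm_num
      ring
    have h2 := hconv 0
    simp only [zero_mul, neg_zero, Real.exp_zero, one_mul] at h2
    have := h2.le_max_of_mem_Icc (mem_univ (-1)) (mem_univ 2)
      (⟨by linarith, by linarith⟩ : β ∈ Icc (-1 : ℝ) 2)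
    rw [h1, max_self] at this
    simpa using this
  have hR2 : R.re ≤ (N 2).re / 4 := by
    rw [← hRβ]
    have h1 : β * (1 - β) ≤ 1 / 4 := by nlinarith [sq_nonneg (β - 1 / 2)]
    have := mul_le_mul h1 hβ2 (hJnonneg β) (by norm_num)
    linarith
  have hG2 : (completedRiemannZeta 2 * M 2).re = (N 2).re + R.re / 2 := by
    rw [hGN 2 (by norm_num) (by norm_num), show R / (2 * (1 - 2)) = ((-1 / 2 : ℝ) : ℂ) * R by
      push_cast; ring, sub_re, re_ofReal_mul]
    ring
  have hG4 : (completedRiemannZeta 4 * M 4).re = (N 4).re + R.re / 12 := by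
    rw [hGN 4 (by norm_num) (by norm_num), show R / (4 * (1 - 4)) = ((-1 / 12 : ℝ) : ℂ) * R by
      push_cast; ring, sub_re, re_ofReal_mul]
    ring
  have hG2' : ‖completedRiemannZeta 2 * M 2‖ = (completedRiemannZeta 2 * M 2).re := by
    obtain ⟨ν, _, hν⟩ := hL
    have := (hν (2 : ℝ) (by simp)).2
    rw [complexMGF_ofReal, ofReal_ofNat] at this
    beta_reduce at this
    rw [this, Complex.norm_real, ofReal_re, Real.norm_of_nonneg mgf_nonneg]
  have hG4' := Complex.re_le_norm (completedRiemannZeta 4 * M 4)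
  simp only [ofReal_ofNat] at hmain
  refine le_trans (mul_le_mul_of_nonneg_left ?_ (Real.exp_pos _).le) (hmain.trans ?_)
  · rw [hG2', hG2]
    linarith
  · linarith

lemma BoundedOnStrips.of_factor {M M₁ : ℂ → ℂ} (hM : BoundedOnStrips M)
    (hM₁ : Continuous M₁) (h : ∀ s, (2 * s - 1) * M₁ s = M s) : BoundedOnStrips M₁ := by
  intro a b
  obtain ⟨C, hC⟩ := hM a b
  obtain ⟨D, hD⟩ := ((isCompact_Icc (a := a) (b := b)).reProdIm
    (isCompact_Icc (a := (-1 : ℝ)) (b := 1))).exists_bound_of_continuousOn hM₁.continuousOn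
  refine ⟨max D C, fun s h1 h2 ↦ ?_⟩
  by_cases him : |s.im| ≤ 1
  · exact (hD s ⟨⟨h1, h2⟩, abs_le.1 him⟩).trans (le_max_left _ _)
  · push Not at him
    refine le_trans ?_ (le_max_right _ _)
    have h3 : 1 ≤ ‖2 * s - 1‖ := by
      have := Complex.abs_im_le_norm (2 * s - 1)
      simp only [sub_im, mul_im, re_ofNat, im_ofNat, zero_mul, add_zero, one_im, sub_zero,
        abs_mul, Nat.abs_ofNat] at this
      linarith
    calc ‖M₁ s‖ = 1 * ‖M₁ s‖ := by ring
      _ ≤ ‖2 * s - 1‖ * ‖M₁ s‖ := by gcongr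
      _ = ‖M s‖ := by rw [← h, norm_mul]
      _ ≤ C := hC s h1 h2

lemma exists_factor_of_antisymm {M : ℂ → ℂ} (hM : Differentiable ℂ M)
    (hsymm : ∀ s, M (1 - s) = -M s) :
    ∃ M₁ : ℂ → ℂ, Differentiable ℂ M₁ ∧ (∀ s, (2 * s - 1) * M₁ s = M s) ∧
      ∀ s, M₁ (1 - s) = M₁ s := by
  have h0 : M (1 / 2) = 0 := by
    have := hsymm (1 / 2)
    rw [show (1 : ℂ) - 1 / 2 = 1 / 2 by norm_num] at this
    exact self_eq_neg.1 this
  have hd : Differentiable ℂ (dslope M (1 / 2)) := by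
    rw [← differentiableOn_univ] at hM ⊢
    exact (Complex.differentiableOn_dslope univ_mem).2 hM
  have hfac (s : ℂ) : (2 * s - 1) * (1 / 2 * dslope M (1 / 2) s) = M s := by
    have := sub_smul_dslope M (1 / 2) s
    rw [h0, sub_zero, smul_eq_mul] at this
    rw [← this]
    ring
  refine ⟨fun s ↦ 1 / 2 * dslope M (1 / 2) s, hd.const_mul _, hfac, fun s ↦ ?_⟩
  by_cases hs : 2 * s - 1 = 0
  · rw [show 1 - s = s by linear_combination -hs]
  · refine mul_left_cancel₀ hs ?_
    have h1 := hfac (1 - s)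
    rw [hsymm] at h1
    rw [hfac s]
    linear_combination -h1

theorem exp_mul_le_of_completedZeta_mul_of_sign {M : ℂ → ℂ} {ε : ℂ} (hM : Differentiable ℂ M)
    (hMb : BoundedOnStrips M) (hsymm : ∀ s, M (1 - s) = ε * M s)
    (hL : IsLaplaceTransform fun s ↦ completedRiemannZeta s * M s) (hne : M 2 ≠ 0)
    {β β' : ℝ} (hβ : 1 / 2 < β) (hββ' : β ≤ β') (hβ' : β' < 1) (hz : M β = 0) (hz' : M β' = 0)
    (heq : β = β' → deriv M β = 0) :
    rexp (2 * (1 / (1 - β) - 1 / β)) * (8 / 9 * ‖completedRiemannZeta 2 * M 2‖) ≤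
      ‖completedRiemannZeta 4 * M 4‖ := by
  have hε : ε = 1 ∨ ε = -1 := by
    have h1 := hsymm (1 - 2)
    rw [hsymm 2, sub_sub_cancel, ← mul_assoc] at h1
    have h2 : ε * ε = 1 := by
      refine mul_right_cancel₀ hne ?_
      rw [← h1, one_mul]
    exact mul_self_eq_one_iff.1 h2
  rcases hε with rfl | rfl
  · exact exp_mul_le_of_completedZeta_mul hM hMb (by simpa using hsymm) hL
      (by linarith) hββ' hβ' hz hz' heq
  · obtain ⟨M₁, hd, hfac, hsymm₁⟩ := exists_factor_of_antisymm hM (by simpa using hsymm)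
    have hne' (t : ℝ) (ht : 1 / 2 < t) : 2 * (t : ℂ) - 1 ≠ 0 := by
      have : 2 * t - 1 ≠ 0 := by linarith
      exact_mod_cast this
    have hzero (t : ℝ) (ht : 1 / 2 < t) (h : M t = 0) : M₁ t = 0 := by
      rw [← hfac] at h
      exact (mul_eq_zero.1 h).resolve_left (hne' t ht)
    have hL₁ : IsLaplaceTransform fun s ↦ completedRiemannZeta s * M₁ s := by
      refine (isLaplaceTransform_inv_two_mul_sub_one.mul hL).congr fun s hs ↦ ?_
      have : 2 * s - 1 ≠ 0 := by
        intro h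
        have := congrArg Complex.re h
        simp at this
        linarith
      rw [← hfac s]
      field_simp
    have h1 := exp_mul_le_of_completedZeta_mul hd (hMb.of_factor hd.continuous hfac) hsymm₁ hL₁
      (by linarith) hββ' hβ' (hzero β hβ hz) (hzero β' (by linarith) hz') fun h ↦ by
        have h2 : HasDerivAt M (2 * M₁ β + (2 * β - 1) * deriv M₁ β) β := by
          have h3 := (((hasDerivAt_id (β : ℂ)).const_mul 2).sub_const 1).mul (hd β).hasDerivAt
          refine (h3.congr_of_eventuallyEq (Eventually.of_forall fun s ↦ ?_)).congr_deriv ?_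
          · exact (hfac s).symm
          · simp
        have h4 := h2.deriv
        rw [heq h, hzero β hβ hz, mul_zero, zero_add] at h4
        exact (mul_eq_zero.1 h4.symm).resolve_left (hne' β hβ)
    have h2 := hfac 2
    have h4 := hfac 4
    rw [← h2, ← h4, norm_mul, norm_mul, norm_mul, norm_mul]
    rw [norm_mul, norm_mul] at h1
    rw [show (2 * 2 - 1 : ℂ) = ((3 : ℝ) : ℂ) by norm_num,
      show (2 * 4 - 1 : ℂ) = ((7 : ℝ) : ℂ) by norm_num, Complex.norm_real, Complex.norm_real]
    norm_num
    have h5 := norm_nonneg (completedRiemannZeta 4)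
    have h6 := norm_nonneg (M₁ 4)
    have := mul_nonneg h5 h6
    norm_num at h1
    linarith

namespace DirichletCharacter

/-- The Dirichlet character as an arithmetic function. -/
noncomputable def arith {N : ℕ} (χ : DirichletCharacter ℂ N) : ArithmeticFunction ℂ :=
  toArithmeticFunction (χ ·)

lemma arith_apply {N : ℕ} (χ : DirichletCharacter ℂ N) {n : ℕ} (hn : n ≠ 0) :
    χ.arith n = χ n :=
  (χ.apply_eq_toArithmeticFunction_apply hn).symm

lemma arith_prime_pow {N : ℕ} (χ : DirichletCharacter ℂ N) {p : ℕ} (hp : p.Prime) (k : ℕ) :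
    χ.arith (p ^ k) = χ p ^ k := by
  rw [arith_apply _ (pow_ne_zero _ hp.ne_zero)]
  simp

lemma LSeriesSummable_arith {N : ℕ} [NeZero N] (χ : DirichletCharacter ℂ N) {s : ℂ}
    (hs : 1 < s.re) : LSeriesSummable χ.arith s :=
  (LSeriesSummable_congr _ fun h ↦ χ.arith_apply h).mpr (ZMod.LSeriesSummable_of_one_lt_re χ hs)

lemma LSeries_arith {N : ℕ} [NeZero N] (χ : DirichletCharacter ℂ N) {s : ℂ}
    (hs : 1 < s.re) : LSeries χ.arith s = LFunction χ s := by
  rw [LFunction_eq_LSeries χ hs]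
  exact LSeries_congr (fun h ↦ χ.arith_apply h) s

lemma LSeries_zetaMul {N : ℕ} [NeZero N] (χ : DirichletCharacter ℂ N) {s : ℂ}
    (hs : 1 < s.re) : LSeries χ.zetaMul s = riemannZeta s * LFunction χ s := by
  rw [zetaMul, ← ArithmeticFunction.coe_mul, LSeries_convolution']
  · congr 1
    · simp_rw [← ArithmeticFunction.LSeries_zeta_eq_riemannZeta hs,
        ← ArithmeticFunction.natCoe_apply]
    · exact χ.LSeries_arith hs
  · exact ArithmeticFunction.LSeriesSummable_zeta_iff.mpr hs
  · exact χ.LSeriesSummable_arith hs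

lemma zetaMul_eq {N : ℕ} (χ : DirichletCharacter ℂ N) :
    χ.zetaMul = (ArithmeticFunction.zeta : ArithmeticFunction ℂ) * χ.arith := rfl

end DirichletCharacter

section PrimePowers

open scoped ComplexOrder
open DirichletCharacter

lemma ArithmeticFunction.mul_prime_pow_nonneg {f g : ArithmeticFunction ℂ} {p : ℕ}
    (hp : p.Prime) (hf : ∀ k, 0 ≤ f (p ^ k)) (hg : ∀ k, 0 ≤ g (p ^ k)) (k : ℕ) :
    0 ≤ (f * g) (p ^ k) := by
  rw [ArithmeticFunction.mul_apply]
  refine Finset.sum_nonneg fun x hx ↦ ?_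
  obtain ⟨h, -⟩ := Nat.mem_divisorsAntidiagonal.1 hx
  obtain ⟨i, -, hi⟩ := (Nat.dvd_prime_pow hp).1 (Dvd.intro _ h)
  obtain ⟨j, -, hj⟩ := (Nat.dvd_prime_pow hp).1 (Dvd.intro_left _ h)
  rw [hi, hj]
  exact mul_nonneg (hf i) (hg j)

lemma ArithmeticFunction.mul_prime_pow_congr {f f' g : ArithmeticFunction ℂ} {p : ℕ}
    (hp : p.Prime) (hf : ∀ k, f (p ^ k) = f' (p ^ k)) (k : ℕ) :
    (f * g) (p ^ k) = (f' * g) (p ^ k) := by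
  simp only [ArithmeticFunction.mul_apply]
  refine Finset.sum_congr rfl fun x hx ↦ ?_
  obtain ⟨h, -⟩ := Nat.mem_divisorsAntidiagonal.1 hx
  obtain ⟨i, -, hi⟩ := (Nat.dvd_prime_pow hp).1 (Dvd.intro _ h)
  rw [hi, hf]

variable {q q' : ℕ} {χ : DirichletCharacter ℂ q} {ψ : DirichletCharacter ℂ q'} {p : ℕ}

lemma arith_mul_prime_pow_nonneg_of_eq_one (hψ : ψ ^ 2 = 1) (hp : p.Prime) (h : χ p = 1)
    (k : ℕ) : 0 ≤ (χ.arith * ψ.arith) (p ^ k) := by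
  rw [ArithmeticFunction.mul_prime_pow_congr (f' := (ArithmeticFunction.zeta :
    ArithmeticFunction ℂ)) hp fun j ↦ ?_, ← zetaMul_eq]
  · exact zetaMul_prime_pow_nonneg hψ hp k
  · rw [arith_prime_pow _ hp, h]
    simp [hp.ne_zero]

lemma arith_mul_prime_pow_nonneg_of_eq_zero (hp : p.Prime) (h : χ p = 0) (h' : ψ p = 0)
    (k : ℕ) : 0 ≤ (χ.arith * ψ.arith) (p ^ k) := by
  refine ArithmeticFunction.mul_prime_pow_nonneg hp (fun j ↦ ?_) (fun j ↦ ?_) k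
  · rw [arith_prime_pow _ hp, h]
    exact pow_nonneg le_rfl j
  · rw [arith_prime_pow _ hp, h']
    exact pow_nonneg le_rfl j

/-- The Dirichlet coefficients of `ζ(s) L(s, χ₁) L(s, χ₂) L(s, χ₃)` are nonnegative, if `χ₃` is
quadratic and agrees with `χ₁ χ₂` at the primes at which `χ₁` or `χ₂` does not vanish. -/
theorem zetaMul_mul_nonneg {q₁ q₂ q₃ : ℕ} {χ₁ : DirichletCharacter ℂ q₁}
    {χ₂ : DirichletCharacter ℂ q₂} {χ₃ : DirichletCharacter ℂ q₃} (h₁ : χ₁ ^ 2 = 1)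
    (h₂ : χ₂ ^ 2 = 1) (h₃ : χ₃ ^ 2 = 1)
    (h : ∀ p : ℕ, p.Prime → χ₁ p ≠ 0 ∨ χ₂ p ≠ 0 → χ₃ p = χ₁ p * χ₂ p) (n : ℕ) :
    0 ≤ (χ₁.zetaMul * (χ₂.arith * χ₃.arith)) n := by
  have hmult : (χ₁.zetaMul * (χ₂.arith * χ₃.arith)).IsMultiplicative :=
    χ₁.isMultiplicative_zetaMul.mul
      ((isMultiplicative_toArithmeticFunction χ₂).mul (isMultiplicative_toArithmeticFunction χ₃))
  rcases eq_or_ne n 0 with rfl | hn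
  · simp
  rw [hmult.multiplicative_factorization _ hn]
  refine Finset.prod_nonneg fun p hp ↦ ?_
  have hp := Nat.prime_of_mem_primeFactors hp
  have hP₁ := zetaMul_prime_pow_nonneg h₁ hp
  have hP₂ := zetaMul_prime_pow_nonneg h₂ hp
  have hP₃ := zetaMul_prime_pow_nonneg h₃ hp
  have e₂ : χ₁.zetaMul * (χ₂.arith * χ₃.arith) = χ₂.zetaMul * (χ₁.arith * χ₃.arith) := by
    simp only [zetaMul_eq]
    ring
  have e₃ : χ₁.zetaMul * (χ₂.arith * χ₃.arith) = χ₃.zetaMul * (χ₁.arith * χ₂.arith) := by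
    simp only [zetaMul_eq]
    ring
  have hp' := h p hp
  rcases MulChar.isQuadratic_iff_sq_eq_one.mpr h₁ p with hx | hx | hx
  · rcases MulChar.isQuadratic_iff_sq_eq_one.mpr h₂ p with hy | hy | hy
    · rw [e₃]
      exact ArithmeticFunction.mul_prime_pow_nonneg hp hP₃
        (arith_mul_prime_pow_nonneg_of_eq_zero hp hx hy) _
    all_goals
      rw [e₂]
      exact ArithmeticFunction.mul_prime_pow_nonneg hp hP₂
        (arith_mul_prime_pow_nonneg_of_eq_zero hp hx (by simp [hp', hx, hy])) _
  · rw [e₂]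
    exact ArithmeticFunction.mul_prime_pow_nonneg hp hP₂
      (arith_mul_prime_pow_nonneg_of_eq_one h₃ hp hx) _
  · rcases MulChar.isQuadratic_iff_sq_eq_one.mpr h₂ p with hy | hy | hy
    · exact ArithmeticFunction.mul_prime_pow_nonneg hp hP₁
        (arith_mul_prime_pow_nonneg_of_eq_zero hp hy (by simp [hp', hx, hy])) _
    · exact ArithmeticFunction.mul_prime_pow_nonneg hp hP₁
        (arith_mul_prime_pow_nonneg_of_eq_one h₃ hp hy) _
    · rw [mul_comm χ₂.arith]
      exact ArithmeticFunction.mul_prime_pow_nonneg hp hP₁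
        (arith_mul_prime_pow_nonneg_of_eq_one h₂ hp (by simp [hp', hx, hy])) _

theorem exists_nonneg_LSeries_eq_zeta_mul_LFunction {q₁ q₂ q₃ : ℕ}
    [NeZero q₁] [NeZero q₂] [NeZero q₃]
    {χ₁ : DirichletCharacter ℂ q₁}
    {χ₂ : DirichletCharacter ℂ q₂} {χ₃ : DirichletCharacter ℂ q₃} (h₁ : χ₁ ^ 2 = 1)
    (h₂ : χ₂ ^ 2 = 1) (h₃ : χ₃ ^ 2 = 1)
    (h : ∀ p : ℕ, p.Prime → χ₁ p ≠ 0 ∨ χ₂ p ≠ 0 → χ₃ p = χ₁ p * χ₂ p) :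
    ∃ f : ℕ → ℝ, (∀ n, 0 ≤ f n) ∧
      ∀ s : ℂ, 1 < s.re → LSeriesSummable (fun n ↦ (f n : ℂ)) s ∧
        LSeries (fun n ↦ (f n : ℂ)) s =
          riemannZeta s * (LFunction χ₁ s * LFunction χ₂ s * LFunction χ₃ s) := by
  have hpos := zetaMul_mul_nonneg h₁ h₂ h₃ h
  refine ⟨fun n ↦ ((χ₁.zetaMul * (χ₂.arith * χ₃.arith)) n).re,
    fun n ↦ (Complex.nonneg_iff.1 (hpos n)).1, fun s hs ↦ ?_⟩
  have hre : (fun n ↦ ((((χ₁.zetaMul * (χ₂.arith * χ₃.arith)) n).re : ℝ) : ℂ)) =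
      ⇑(χ₁.zetaMul * (χ₂.arith * χ₃.arith)) := by
    ext n
    exact Complex.ext (by simp) (by simpa using (Complex.nonneg_iff.1 (hpos n)).2)
  have hs₂₃ := ArithmeticFunction.LSeriesSummable_mul (χ₂.LSeriesSummable_arith hs)
    (χ₃.LSeriesSummable_arith hs)
  rw [hre]
  refine ⟨ArithmeticFunction.LSeriesSummable_mul (χ₁.LSeriesSummable_zetaMul hs) hs₂₃, ?_⟩
  rw [ArithmeticFunction.LSeries_mul' (χ₁.LSeriesSummable_zetaMul hs) hs₂₃,
    LSeries_zetaMul _ hs,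
    ArithmeticFunction.LSeries_mul' (χ₂.LSeriesSummable_arith hs) (χ₃.LSeriesSummable_arith hs),
    LSeries_arith _ hs, LSeries_arith _ hs]
  ring

end PrimePowers

namespace DirichletCharacter

lemma natCast_apply_eq_zero_iff {N : ℕ} (χ : DirichletCharacter ℂ N) {p : ℕ} (hp : p.Prime) :
    χ p = 0 ↔ p ∣ N := by
  have := χ.apply_eq_zero_iff (p : ℤ)
  rw [Int.cast_natCast] at this
  rw [this, Nat.isCoprime_iff_coprime, hp.coprime_iff_not_dvd, not_not]

lemma changeLevel_natCast {n m : ℕ} (χ : DirichletCharacter ℂ n) (h : n ∣ m) {p : ℕ}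
    (hp : p.Coprime m) : changeLevel h χ p = χ p := by
  have := χ.changeLevel_eq_cast_of_dvd' h (a := p) (Nat.isCoprime_iff_coprime.2 hp)
  simpa using this

lemma IsPrimitive.dvd_of_changeLevel_eq {n m N : ℕ} [NeZero N] {χ : DirichletCharacter ℂ n}
    (hχ : χ.IsPrimitive) (hn : n ∣ N) (hm : m ∣ N) {ψ : DirichletCharacter ℂ m}
    (h : changeLevel hn χ = changeLevel hm ψ) : n ∣ m := by
  have h1 : (changeLevel hn χ).FactorsThrough m := by
    rw [h]
    exact changeLevel_factorsThrough ψ hm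
  have h2 := (mem_conductorSet_iff_conductor_dvd (changeLevel hn χ) hm).1 h1
  rwa [conductor_changeLevel, hχ] at h2

/-- The primitive character inducing the product of two distinct primitive quadratic characters. -/
theorem exists_primitive_mul {q₁ q₂ : ℕ} [NeZero q₁] [NeZero q₂]
    {χ₁ : DirichletCharacter ℂ q₁} {χ₂ : DirichletCharacter ℂ q₂} (h₁ : χ₁ ^ 2 = 1)
    (h₂ : χ₂ ^ 2 = 1) (hp₁ : χ₁.IsPrimitive) (hp₂ : χ₂.IsPrimitive)
    (hne : ∀ h : q₁ = q₂, h ▸ χ₁ ≠ χ₂) :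
    ∃ (q₃ : ℕ) (_ : NeZero q₃) (χ₃ : DirichletCharacter ℂ q₃), q₃ ∣ q₁ * q₂ ∧ χ₃.IsPrimitive ∧
      χ₃ ≠ 1 ∧ χ₃ ^ 2 = 1 ∧
      ∀ p : ℕ, p.Prime → χ₁ p ≠ 0 ∨ χ₂ p ≠ 0 → χ₃ p = χ₁ p * χ₂ p := by
  have d₁ : q₁ ∣ q₁ * q₂ := dvd_mul_right _ _
  have d₂ : q₂ ∣ q₁ * q₂ := dvd_mul_left _ _
  set ψ := changeLevel d₁ χ₁ * changeLevel d₂ χ₂ with hψ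
  have d₃ : ψ.conductor ∣ q₁ * q₂ := ψ.conductor_dvd_level
  have : NeZero ψ.conductor := ⟨ψ.conductor_ne_zero⟩
  have hlift : changeLevel d₃ ψ.primitiveCharacter = ψ := ψ.changeLevel_primitiveCharacter
  have hs₁ : changeLevel d₁ χ₁ * changeLevel d₁ χ₁ = 1 := by
    rw [← map_mul, ← sq, h₁, map_one]
  have hs₂ : changeLevel d₂ χ₂ * changeLevel d₂ χ₂ = 1 := by
    rw [← map_mul, ← sq, h₂, map_one]
  have e₁ : changeLevel d₁ χ₁ = changeLevel d₂ χ₂ * ψ := by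
    rw [hψ, mul_left_comm, hs₂, mul_one]
  have e₂ : changeLevel d₂ χ₂ = changeLevel d₁ χ₁ * ψ := by
    rw [hψ, ← mul_assoc, hs₁, one_mul]
  refine ⟨ψ.conductor, inferInstance, ψ.primitiveCharacter, d₃, ψ.primitiveCharacter_isPrimitive,
    fun h ↦ ?_, ?_, fun p hp hxy ↦ ?_⟩
  · rw [h, map_one] at hlift
    rw [← hlift, mul_one] at e₁ e₂
    obtain rfl : q₁ = q₂ := Nat.dvd_antisymm (hp₁.dvd_of_changeLevel_eq d₁ d₂ e₁)
      (hp₂.dvd_of_changeLevel_eq d₂ d₁ e₂)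
    exact hne rfl (changeLevel_injective d₁ e₁)
  · refine changeLevel_injective d₃ ?_
    rw [map_pow, hlift, map_one, hψ, mul_pow, sq, sq, hs₁, hs₂, one_mul]
  · have key {a b : ℕ} [NeZero a] [NeZero b] (α : DirichletCharacter ℂ a)
        (γ : DirichletCharacter ℂ b) (hα : α.IsPrimitive) (da : a ∣ q₁ * q₂) (db : b ∣ q₁ * q₂)
        (h : changeLevel da α = changeLevel db γ * ψ) (hpa : p ∣ a) (hpb : ¬ p ∣ b) :
        p ∣ ψ.conductor := by
      have h1 : a ∣ Nat.lcm b ψ.conductor := by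
        refine hα.dvd_of_changeLevel_eq da (Nat.lcm_dvd db d₃) (ψ := changeLevel
          (Nat.dvd_lcm_left _ _) γ * changeLevel (Nat.dvd_lcm_right _ _) ψ.primitiveCharacter) ?_
        rw [map_mul, ← changeLevel_trans, ← changeLevel_trans, hlift, h]
      exact (hp.dvd_mul.1 ((hpa.trans h1).trans (Nat.lcm_dvd_mul _ _))).resolve_left hpb
    by_cases hp1 : p ∣ q₁
    · have hp2 : ¬ p ∣ q₂ := by
        rw [← χ₂.natCast_apply_eq_zero_iff hp]
        exact hxy.resolve_left (not_not.2 ((χ₁.natCast_apply_eq_zero_iff hp).2 hp1))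
      rw [(χ₁.natCast_apply_eq_zero_iff hp).2 hp1, zero_mul, natCast_apply_eq_zero_iff _ hp]
      exact key χ₁ χ₂ hp₁ d₁ d₂ e₁ hp1 hp2
    · by_cases hp2 : p ∣ q₂
      · rw [(χ₂.natCast_apply_eq_zero_iff hp).2 hp2, mul_zero, natCast_apply_eq_zero_iff _ hp]
        exact key χ₂ χ₁ hp₂ d₂ d₁ e₂ hp2 hp1
      · have hc : p.Coprime (q₁ * q₂) :=
          Nat.Coprime.mul_right ((hp.coprime_iff_not_dvd).2 hp1) ((hp.coprime_iff_not_dvd).2 hp2)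
        rw [← changeLevel_natCast _ d₃ hc, hlift, hψ, MulChar.mul_apply,
          changeLevel_natCast _ d₁ hc, changeLevel_natCast _ d₂ hc]

lemma sq_eq_one_of_im_eq_zero {N : ℕ} [NeZero N] {χ : DirichletCharacter ℂ N}
    (h : ∀ n, (χ n).im = 0) : χ ^ 2 = 1 := by
  ext u
  have h1 : ‖χ u‖ = 1 := χ.unit_norm_eq_one u
  obtain ⟨r, hr⟩ : ∃ r : ℝ, χ u = r := ⟨(χ u).re, Complex.ext (by simp) (by simp [h])⟩
  rw [MulChar.pow_apply_coe, MulChar.one_apply_coe, hr]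
  rw [hr, Complex.norm_real, Real.norm_eq_abs] at h1
  have : r ^ 2 = 1 := by rw [← sq_abs, h1, one_pow]
  exact_mod_cast this

end DirichletCharacter

lemma Complex.norm_Gammaℝ_add_two_le {a : ℝ} (ha : 0 < a) (ha' : a ≤ 3) :
    ‖Gammaℝ (a + 2)‖ ≤ ‖Gammaℝ a‖ := by
  have hne : (a : ℂ) ≠ 0 := by exact_mod_cast ha.ne'
  rw [Gammaℝ_add_two hne]
  simp only [norm_div, norm_mul, norm_real, Real.norm_of_nonneg ha.le,
    Real.norm_of_nonneg Real.pi_pos.le, Complex.norm_ofNat]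
  rw [div_div, div_le_iff₀ (by positivity)]
  gcongr
  linarith [Real.pi_gt_three]

lemma norm_LSeries_le_of_nonneg {f : ℕ → ℝ} (hf : ∀ n, 0 ≤ f n) {x y : ℝ} (hxy : x ≤ y)
    (hs : LSeriesSummable (fun n ↦ (f n : ℂ)) x) :
    ‖LSeries (fun n ↦ (f n : ℂ)) y‖ ≤ ‖LSeries (fun n ↦ (f n : ℂ)) x‖ := by
  have key : ∀ n, LSeries.term (fun n ↦ (f n : ℂ)) x n =
      ((‖LSeries.term (fun n ↦ (f n : ℂ)) x n‖ : ℝ) : ℂ) := by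
    intro n
    rcases eq_or_ne n 0 with rfl | hn
    · simp
    · rw [LSeries.term_of_ne_zero hn, norm_div, Complex.norm_natCast_cpow_of_pos (by omega),
        norm_real, Real.norm_of_nonneg (hf n), ofReal_div, ofReal_cpow (Nat.cast_nonneg n)]
      simp
  have hle (n : ℕ) : ‖LSeries.term (fun n ↦ (f n : ℂ)) y n‖ ≤
      ‖LSeries.term (fun n ↦ (f n : ℂ)) x n‖ :=
    LSeries.norm_term_le_of_re_le_re _ (by simpa using hxy) n
  have hs' : Summable fun n ↦ ‖LSeries.term (fun n ↦ (f n : ℂ)) x n‖ := hs.norm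
  have e : LSeries (fun n ↦ (f n : ℂ)) x =
      ((∑' n, ‖LSeries.term (fun n ↦ (f n : ℂ)) x n‖ : ℝ) : ℂ) := by
    rw [LSeries, ofReal_tsum]
    exact tsum_congr key
  calc ‖LSeries (fun n ↦ (f n : ℂ)) y‖
      ≤ ∑' n, ‖LSeries.term (fun n ↦ (f n : ℂ)) y n‖ :=
        norm_tsum_le_tsum_norm (hs'.of_nonneg_of_le (fun _ ↦ norm_nonneg _) hle)
    _ ≤ ∑' n, ‖LSeries.term (fun n ↦ (f n : ℂ)) x n‖ :=
        (hs'.of_nonneg_of_le (fun _ ↦ norm_nonneg _) hle).tsum_le_tsum hle hs'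
    _ = _ := by rw [e, norm_real, Real.norm_of_nonneg (tsum_nonneg fun _ ↦ norm_nonneg _)]

lemma lt_exp_two_mul_of_log_lt {L β : ℝ} (hL : 2 ≤ L) (hβ : 1 - 1 / (2.0452 * L) < β)
    (hβ' : β < 1) : 1 / 2 < β ∧ 2 * L + 1 / 4 < 2 * (1 / (1 - β) - 1 / β) := by
  have h0 : (0 : ℝ) < 2.0452 * L := by positivity
  have h1 : 1 / (2.0452 * L) ≤ 1 / 4 := by
    apply one_div_le_one_div_of_le <;> linarith
  have h2 : 3 / 4 < β := by linarith
  have h3 : 2.0452 * L < 1 / (1 - β) := by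
    rw [lt_div_iff₀ (by linarith), mul_comm, ← lt_div_iff₀ h0]
    linarith
  have h4 : 1 / β < 4 / 3 := by
    rw [div_lt_iff₀ (by linarith)]; linarith
  exact ⟨by linarith, by linarith⟩

namespace DirichletCharacter

/-- The gamma factor of `χ`, with the parity of `χ` as a shift. -/
lemma exists_gammaFactor_eq {N : ℕ} (χ : DirichletCharacter ℂ N) :
    ∃ a : ℝ, 0 ≤ a ∧ a ≤ 1 ∧ ∀ s, gammaFactor χ s = Gammaℝ (s + a) := by
  rcases χ.even_or_odd with h | h
  · exact ⟨0, le_rfl, zero_le_one, fun s ↦ by simp [h.gammaFactor_def]⟩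
  · exact ⟨1, zero_le_one, le_rfl, fun s ↦ by simp [h.gammaFactor_def]⟩

lemma gammaFactor_ne_zero {N : ℕ} (χ : DirichletCharacter ℂ N) {s : ℂ} (hs : 0 < s.re) :
    gammaFactor χ s ≠ 0 := by
  obtain ⟨a, ha, -, h⟩ := χ.exists_gammaFactor_eq
  rw [h]
  refine Gammaℝ_ne_zero_of_re_pos ?_
  rw [add_re, ofReal_re]
  linarith

variable {N : ℕ} [NeZero N] {χ : DirichletCharacter ℂ N}

/-- The completed L-function, multiplied by the power of the level which makes the functional
equation symmetric. -/
noncomputable def symmetricLFunction (χ : DirichletCharacter ℂ N) (s : ℂ) : ℂ :=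
  (√N : ℝ) ^ s * completedLFunction χ s

lemma sqrt_level_pos (N : ℕ) [NeZero N] : 0 < √(N : ℝ) :=
  Real.sqrt_pos.2 <| by exact_mod_cast NeZero.pos N

lemma differentiable_symmetricLFunction (hχ : χ ≠ 1) :
    Differentiable ℂ (symmetricLFunction χ) := by
  have h : ((√N : ℝ) : ℂ) ≠ 0 := by exact_mod_cast (sqrt_level_pos N).ne'
  exact (differentiable_id.const_cpow (.inl h)).mul (differentiable_completedLFunction hχ)

lemma boundedOnStrips_symmetricLFunction (hχ : χ ≠ 1) :
    BoundedOnStrips (symmetricLFunction χ) :=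
  (BoundedOnStrips.cpow (sqrt_level_pos N)).mul (boundedOnStrips_completedLFunction hχ)

lemma symmetricLFunction_one_sub (hχ : χ.IsPrimitive) (h : χ ^ 2 = 1) (s : ℂ) :
    symmetricLFunction χ (1 - s) = rootNumber χ * symmetricLFunction χ s := by
  have hinv : χ⁻¹ = χ := inv_eq_of_mul_eq_one_left (by rw [← sq, h])
  have hc := sqrt_level_pos N
  have hne : ((√N : ℝ) : ℂ) ≠ 0 := by exact_mod_cast hc.ne'
  have hN : (N : ℂ) = ((√N : ℝ) : ℂ) * ((√N : ℝ) : ℂ) := by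
    rw [← ofReal_mul, Real.mul_self_sqrt (Nat.cast_nonneg N), ofReal_natCast]
  have hpow : ((√N : ℝ) : ℂ) ^ (1 - s) * (N : ℂ) ^ (s - 1 / 2) = ((√N : ℝ) : ℂ) ^ s := by
    rw [hN, mul_cpow_ofReal_nonneg hc.le hc.le, ← cpow_add _ _ hne, ← cpow_add _ _ hne]
    congr 1
    ring
  rw [symmetricLFunction, symmetricLFunction, hχ.completedLFunction_one_sub, hinv, ← hpow]
  ring

/-- The archimedean part of the symmetric completed L-function. -/
noncomputable def symmetricFactor (χ : DirichletCharacter ℂ N) (s : ℂ) : ℂ :=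
  (√N : ℝ) ^ s * gammaFactor χ s

lemma symmetricFactor_ne_zero (χ : DirichletCharacter ℂ N) {s : ℂ} (hs : 0 < s.re) :
    symmetricFactor χ s ≠ 0 := by
  refine mul_ne_zero ?_ (χ.gammaFactor_ne_zero hs)
  rw [cpow_ne_zero_iff_of_exponent_ne_zero (by rintro rfl; simp at hs)]
  exact_mod_cast (sqrt_level_pos N).ne'

lemma symmetricLFunction_eq (χ : DirichletCharacter ℂ N) {s : ℂ} (hs : 0 < s.re) :
    symmetricLFunction χ s = symmetricFactor χ s * LFunction χ s := by
  rw [symmetricLFunction, symmetricFactor, LFunction_eq_completed_div_gammaFactor _ _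
    (.inl (by rintro rfl; simp at hs)), mul_assoc, mul_div_cancel₀ _ (χ.gammaFactor_ne_zero hs)]

lemma isLaplaceTransform_symmetricFactor (χ : DirichletCharacter ℂ N) :
    IsLaplaceTransform (symmetricFactor χ) := by
  obtain ⟨a, ha, -, h⟩ := χ.exists_gammaFactor_eq
  refine ((isLaplaceTransform_cpow (sqrt_level_pos N)).mul (isLaplaceTransform_Gammaℝ ha)).congr ?_
  intro s _
  simp only [symmetricFactor, h]

lemma norm_symmetricFactor_four_le (χ : DirichletCharacter ℂ N) :
    ‖symmetricFactor χ 4‖ ≤ N * ‖symmetricFactor χ 2‖ := by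
  obtain ⟨a, ha, ha', h⟩ := χ.exists_gammaFactor_eq
  have h4 : ‖gammaFactor χ 4‖ ≤ ‖gammaFactor χ 2‖ := by
    rw [h, h]
    convert norm_Gammaℝ_add_two_le (a := 2 + a) (by linarith) (by linarith) using 3
    · push_cast; ring
    · push_cast; ring
  have e (x : ℝ) : ‖((√N : ℝ) : ℂ) ^ (x : ℂ)‖ = √N ^ x := by
    rw [norm_cpow_eq_rpow_re_of_pos (sqrt_level_pos N), ofReal_re]
  have e4 : ‖((√N : ℝ) : ℂ) ^ (4 : ℂ)‖ = N * N := by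
    have := e 4
    rw [show (4 : ℝ) = (4 : ℕ) by norm_num, Real.rpow_natCast] at this
    rw [show (4 : ℂ) = (((4 : ℕ) : ℝ) : ℂ) by norm_num, this,
      show √(N : ℝ) ^ 4 = (√(N : ℝ) ^ 2) * (√(N : ℝ) ^ 2) by ring, Real.sq_sqrt (Nat.cast_nonneg N)]
  have e2 : ‖((√N : ℝ) : ℂ) ^ (2 : ℂ)‖ = N := by
    have := e 2
    rw [show (2 : ℝ) = (2 : ℕ) by norm_num, Real.rpow_natCast] at this
    rw [show (2 : ℂ) = (((2 : ℕ) : ℝ) : ℂ) by norm_num, this, Real.sq_sqrt (Nat.cast_nonneg N)]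
  rw [symmetricFactor, symmetricFactor, norm_mul, norm_mul, e4, e2, mul_assoc]
  gcongr

/-- Two real zeros of a pair of distinct primitive quadratic L-functions repel each other. -/
theorem exp_mul_le_of_LFunction_eq_zero {q₁ q₂ : ℕ} [NeZero q₁] [NeZero q₂]
    {χ₁ : DirichletCharacter ℂ q₁} {χ₂ : DirichletCharacter ℂ q₂}
    (h₁ : χ₁ ^ 2 = 1) (h₂ : χ₂ ^ 2 = 1) (n₁ : χ₁ ≠ 1) (n₂ : χ₂ ≠ 1)
    (hp₁ : χ₁.IsPrimitive) (hp₂ : χ₂.IsPrimitive) (hne : ∀ h : q₁ = q₂, h ▸ χ₁ ≠ χ₂)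
    {β β' : ℝ} (hβ : 1 / 2 < β) (hββ' : β ≤ β') (hβ' : β' < 1)
    (hz : LFunction χ₁ β = 0 ∧ LFunction χ₂ β' = 0 ∨ LFunction χ₁ β' = 0 ∧ LFunction χ₂ β = 0) :
    rexp (2 * (1 / (1 - β) - 1 / β)) * (8 / 9) ≤ (q₁ * q₂ : ℝ) ^ 2 := by
  obtain ⟨q₃, _, χ₃, hd, hp₃, n₃, h₃, hcompat⟩ := exists_primitive_mul h₁ h₂ hp₁ hp₂ hne
  obtain ⟨f, hf, hs⟩ := exists_nonneg_LSeries_eq_zeta_mul_LFunction h₁ h₂ h₃ hcompat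
  let M : ℂ → ℂ := fun s ↦
    symmetricLFunction χ₁ s * symmetricLFunction χ₂ s * symmetricLFunction χ₃ s
  let P : ℂ → ℂ := fun s ↦
    Gammaℝ s * (symmetricFactor χ₁ s * symmetricFactor χ₂ s * symmetricFactor χ₃ s)
  have hd₁ := differentiable_symmetricLFunction n₁
  have hd₂ := differentiable_symmetricLFunction n₂
  have hd₃ := differentiable_symmetricLFunction n₃
  have hM : Differentiable ℂ M := (hd₁.mul hd₂).mul hd₃
  have hPM (s : ℂ) (h : 1 < s.re) :
      P s * LSeries (fun n ↦ (f n : ℂ)) s = completedRiemannZeta s * M s := by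
    have h0 : 0 < s.re := by linarith
    have hs0 : s ≠ 0 := by rintro rfl; simp at h0
    have hζ : completedRiemannZeta s = Gammaℝ s * riemannZeta s := by
      rw [riemannZeta_def_of_ne_zero hs0, mul_div_cancel₀ _ (Gammaℝ_ne_zero_of_re_pos h0)]
    simp only [M, P, (hs s h).2, hζ, symmetricLFunction_eq _ h0]
    ring
  have hP : IsLaplaceTransform P :=
    ((isLaplaceTransform_Gammaℝ le_rfl).congr fun s _ ↦ by simp).mul
      (((isLaplaceTransform_symmetricFactor χ₁).mul (isLaplaceTransform_symmetricFactor χ₂)).mul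
        (isLaplaceTransform_symmetricFactor χ₃))
  have hL : IsLaplaceTransform fun s ↦ completedRiemannZeta s * M s :=
    (hP.mul (isLaplaceTransform_LSeries hf fun s h ↦ (hs s h).1)).congr hPM
  have hsymm (s : ℂ) :
      M (1 - s) = (rootNumber χ₁ * rootNumber χ₂ * rootNumber χ₃) * M s := by
    simp only [M, symmetricLFunction_one_sub hp₁ h₁, symmetricLFunction_one_sub hp₂ h₂,
      symmetricLFunction_one_sub hp₃ h₃]
    ring
  have hM2 : M 2 ≠ 0 := by
    have key {N : ℕ} [NeZero N] {χ : DirichletCharacter ℂ N} (n : χ ≠ 1) :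
        symmetricLFunction χ 2 ≠ 0 := by
      rw [symmetricLFunction_eq _ (by simp)]
      exact mul_ne_zero (symmetricFactor_ne_zero _ (by simp))
        (LFunction_ne_zero_of_one_le_re _ (.inl n) (by simp))
    exact mul_ne_zero (mul_ne_zero (key n₁) (key n₂)) (key n₃)
  have key {N : ℕ} [NeZero N] {χ : DirichletCharacter ℂ N} {x : ℝ} (hx : 1 / 2 < x)
      (h : LFunction χ x = 0) : symmetricLFunction χ x = 0 := by
    rw [symmetricLFunction_eq _ (by rw [ofReal_re]; linarith), h, mul_zero]
  have hx' : 1 / 2 < β' := by linarith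
  have hz1 : M β = 0 := by
    rcases hz with ⟨h, -⟩ | ⟨-, h⟩ <;> simp [M, key hβ h]
  have hz2 : M β' = 0 := by
    rcases hz with ⟨-, h⟩ | ⟨h, -⟩ <;> simp [M, key hx' h]
  have hz3 : β = β' → deriv M β = 0 := by
    rintro rfl
    have hz12 : symmetricLFunction χ₁ β = 0 ∧ symmetricLFunction χ₂ β = 0 := by
      rcases hz with ⟨h, h'⟩ | ⟨h, h'⟩ <;> exact ⟨key hβ h, key hβ h'⟩
    have := (((hd₁ β).hasDerivAt.mul (hd₂ β).hasDerivAt).mul (hd₃ β).hasDerivAt).deriv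
    rw [show M = symmetricLFunction χ₁ * symmetricLFunction χ₂ * symmetricLFunction χ₃ from rfl,
      this]
    simp [hz12]
  have hmain := exp_mul_le_of_completedZeta_mul_of_sign hM
    (((boundedOnStrips_symmetricLFunction n₁).mul (boundedOnStrips_symmetricLFunction n₂)).mul
      (boundedOnStrips_symmetricLFunction n₃)) hsymm hL hM2 hβ hββ' hβ' hz1 hz2 hz3
  have hP4 : ‖P 4‖ ≤ (q₁ * q₂ : ℝ) ^ 2 * ‖P 2‖ := by
    have hΓ : ‖Gammaℝ 4‖ ≤ ‖Gammaℝ 2‖ := by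
      convert norm_Gammaℝ_add_two_le (a := 2) (by norm_num) (by norm_num) using 3
      all_goals norm_num
    have hq₃ : (q₃ : ℝ) ≤ q₁ * q₂ := by
      exact_mod_cast Nat.le_of_dvd (NeZero.pos _) hd
    simp only [P, norm_mul]
    calc _ ≤ ‖Gammaℝ 2‖ * (q₁ * ‖symmetricFactor χ₁ 2‖ * (q₂ * ‖symmetricFactor χ₂ 2‖) *
            (q₁ * q₂ * ‖symmetricFactor χ₃ 2‖)) := by
          gcongr
          · exact norm_symmetricFactor_four_le χ₁
          · exact norm_symmetricFactor_four_le χ₂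
          · exact (norm_symmetricFactor_four_le χ₃).trans (by gcongr)
      _ = _ := by ring
  have hF : ‖LSeries (fun n ↦ (f n : ℂ)) 4‖ ≤ ‖LSeries (fun n ↦ (f n : ℂ)) 2‖ := by
    have := norm_LSeries_le_of_nonneg hf (x := 2) (y := 4) (by norm_num)
      (hs _ (by simp)).1
    simpa using this
  have h42 : ‖completedRiemannZeta 4 * M 4‖ ≤
      (q₁ * q₂ : ℝ) ^ 2 * ‖completedRiemannZeta 2 * M 2‖ := by
    rw [← hPM 4 (by simp), ← hPM 2 (by simp), norm_mul (P 4), norm_mul (P 2), ← mul_assoc]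
    gcongr
  have hpos : 0 < ‖completedRiemannZeta 2 * M 2‖ := by
    refine norm_pos_iff.2 (mul_ne_zero ?_ hM2)
    have := riemannZeta_ne_zero_of_one_lt_re (s := 2) (by simp)
    rw [riemannZeta_def_of_ne_zero two_ne_zero] at this
    exact fun h ↦ this (by rw [h, zero_div])
  refine le_of_mul_le_mul_right ?_ hpos
  rw [mul_assoc]
  exact hmain.trans h42

lemma lt_one_of_LFunction_eq_zero (hχ : χ ≠ 1) {β : ℝ} (h : LFunction χ β = 0) : β < 1 := by
  by_contra! hβ
  exact LFunction_ne_zero_of_one_le_re χ (.inl hχ) (by simpa using hβ) h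

end DirichletCharacter

end

/-- **Theorem 3 (Kadiri).** If `χ₁` and `χ₂` are two distinct real non-principal primitive
Dirichlet characters of conductors `q₁ ≥ 3` and `q₂ ≥ 3` respectively, and `β₁`, `β₂` are
real zeros of `L(s,χ₁)` and `L(s,χ₂)` respectively, then
`min β₁ β₂ ≤ 1 - 1/(2.0452 * log (q₁ q₂))`. -/
theorem real_zeros_repulsion_two_characters (q₁ q₂ : ℕ) (hq₁ : 3 ≤ q₁) (hq₂ : 3 ≤ q₂)
    (χ₁ : DirichletCharacter ℂ q₁) (χ₂ : DirichletCharacter ℂ q₂)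
    (hχ₁_nonprincipal : χ₁ ≠ 1) (hχ₂_nonprincipal : χ₂ ≠ 1)
    (hχ₁_real : ∀ n : ZMod q₁, (χ₁ n).im = 0)
    (hχ₂_real : ∀ n : ZMod q₂, (χ₂ n).im = 0)
    (hχ₁_primitive : χ₁.conductor = q₁)
    (hχ₂_primitive : χ₂.conductor = q₂)
    (hdistinct : ∀ h : q₁ = q₂, h ▸ χ₁ ≠ χ₂)
    (β₁ β₂ : ℝ) :
    letI : NeZero q₁ := ⟨by omega⟩
    letI : NeZero q₂ := ⟨by omega⟩
    DirichletCharacter.LFunction χ₁ β₁ = 0 →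
    DirichletCharacter.LFunction χ₂ β₂ = 0 →
    min β₁ β₂ ≤ 1 - 1 / (2.0452 * Real.log (q₁ * q₂)) := by
  have : NeZero q₁ := ⟨by omega⟩
  have : NeZero q₂ := ⟨by omega⟩
  intro hz₁ hz₂
  by_contra! hlt
  have hq : (9 : ℝ) ≤ q₁ * q₂ := by exact_mod_cast Nat.mul_le_mul hq₁ hq₂
  have hL : 2 ≤ Real.log (q₁ * q₂) := by
    rw [Real.le_log_iff_exp_le (by linarith)]
    have h := Real.exp_one_lt_d9
    calc rexp 2 = rexp 1 * rexp 1 := by rw [← Real.exp_add]; norm_num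
      _ ≤ 3 * 3 := by gcongr <;> linarith
      _ ≤ _ := by linarith
  have hβ₁ := DirichletCharacter.lt_one_of_LFunction_eq_zero hχ₁_nonprincipal hz₁
  have hβ₂ := DirichletCharacter.lt_one_of_LFunction_eq_zero hχ₂_nonprincipal hz₂
  obtain ⟨hhalf, hC⟩ := lt_exp_two_mul_of_log_lt hL hlt ((min_le_left _ _).trans_lt hβ₁)
  have hmain := DirichletCharacter.exp_mul_le_of_LFunction_eq_zero
    (DirichletCharacter.sq_eq_one_of_im_eq_zero hχ₁_real)
    (DirichletCharacter.sq_eq_one_of_im_eq_zero hχ₂_real)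
    hχ₁_nonprincipal hχ₂_nonprincipal hχ₁_primitive hχ₂_primitive hdistinct hhalf
    min_le_max (max_lt hβ₁ hβ₂) (by
      rcases le_total β₁ β₂ with h | h
      · exact .inl (by simp [h, hz₁, hz₂])
      · exact .inr (by simp [h, hz₁, hz₂]))
  have hexp : rexp (2 * Real.log (q₁ * q₂)) = (q₁ * q₂ : ℝ) ^ 2 := by
    rw [mul_comm, Real.exp_mul, Real.exp_log (by linarith)]
    norm_cast
  have hlow : (q₁ * q₂ : ℝ) ^ 2 * (5 / 4) ≤ rexp (2 * (1 / (1 - min β₁ β₂) - 1 / min β₁ β₂)) := by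
    calc (q₁ * q₂ : ℝ) ^ 2 * (5 / 4) ≤ rexp (2 * Real.log (q₁ * q₂)) * rexp (1 / 4) := by
          rw [hexp]
          gcongr
          linarith [Real.add_one_le_exp (1 / 4 : ℝ)]
      _ = rexp (2 * Real.log (q₁ * q₂) + 1 / 4) := (Real.exp_add _ _).symm
      _ ≤ _ := Real.exp_le_exp.2 hC.le
  nlinarith [hmain, hlow, hq]
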